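/- arXiv:2402.12992 — 10 statements merged into one kernel-verified Lean document; each statement's English description precedes it below -/
import Mathlib

section
/- Let N > 0, Ω = (Ω₁, Ω₂, Ω₃) ∈ ℝ³, f := 2‖Ω‖, and let A be the real 4×4 matrix A = [[0, −2Ω₃, 2Ω₂, 0], [2Ω₃, 0, −2Ω₁, 0], [−2Ω₂, 2Ω₁, 0, N], [0, 0, −N, 0]]. Then the characteristic polynomial of the complex matrix iA satisfies det(X·I₄ − iA) = X⁴ − (N² + f²)X² + 4N²Ω₃² (as a polynomial identity, equivalently for every λ ∈ ℂ). -/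
/-- The characteristic polynomial of `iA` is `X⁴ − (N² + f²)X² + 4N²Ω₃²`,
stated as an identity valid for every `λ ∈ ℂ`. -/
theorem stmt_1 (N Ω₁ Ω₂ Ω₃ f : ℝ) (hN : 0 < N)
    (hf : f = 2 * Real.sqrt (Ω₁ ^ 2 + Ω₂ ^ 2 + Ω₃ ^ 2))
    (A : Matrix (Fin 4) (Fin 4) ℝ)
    (hA : A = !![0, -2*Ω₃, 2*Ω₂, 0;
                 2*Ω₃, 0, -2*Ω₁, 0;
                 -2*Ω₂, 2*Ω₁, 0, N;
                 0, 0, -N, 0]) :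
    ∀ lam : ℂ,
      Matrix.det (lam • (1 : Matrix (Fin 4) (Fin 4) ℂ) - Complex.I • A.map Complex.ofReal) =
        lam ^ 4 - ((N : ℂ) ^ 2 + (f : ℂ) ^ 2) * lam ^ 2 + 4 * (N : ℂ) ^ 2 * (Ω₃ : ℂ) ^ 2 := by
  intro lam
  have hf2 : (f : ℂ) ^ 2 = 4 * ((Ω₁ : ℂ) ^ 2 + (Ω₂ : ℂ) ^ 2 + (Ω₃ : ℂ) ^ 2) := by
    have h : f ^ 2 = 4 * (Ω₁ ^ 2 + Ω₂ ^ 2 + Ω₃ ^ 2) := by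
      rw [hf, mul_pow, Real.sq_sqrt (by positivity)]
      norm_num
    exact_mod_cast h
  rw [hf2, hA]
  simp [Matrix.det_succ_row_zero, Fin.sum_univ_succ, Fin.succAbove, Matrix.one_apply]
  linear_combination
    (lam ^ 2 * ((N : ℂ) ^ 2 + 4 * ((Ω₁ : ℂ) ^ 2 + (Ω₂ : ℂ) ^ 2 + (Ω₃ : ℂ) ^ 2)) +
      (Complex.I ^ 2 - 1) * (4 * (N : ℂ) ^ 2 * (Ω₃ : ℂ) ^ 2)) * Complex.I_sq
end

section
/- Let N > 0, Ω = (Ω₁, Ω₂, Ω₃) ∈ ℝ³, f := 2‖Ω‖, A the 4×4 matrix A = [[0, −2Ω₃, 2Ω₂, 0], [2Ω₃, 0, −2Ω₁, 0], [−2Ω₂, 2Ω₁, 0, N], [0, 0, −N, 0]], and ω± := √((N² + f² ± √((N²+f²)² − 16N²Ω₃²))/2). Then a complex number λ is an eigenvalue of the Hermitian matrix iA if and only if λ ∈ {ω₊, ω₋, −ω₋, −ω₊}; consequently, for ω ∈ ℂ the matrix ω·I₄ − iA is invertible if and only if ω ∉ {ω₊, ω₋, −ω₋, −ω₊}. -/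
/-- The roots `x` and `y` (up to sign) of the biquadratic `t ^ 4 - b * t ^ 2 + c`, written with
nested square roots, satisfy Vieta's relations. -/
theorem sq_add_sq_and_sq_mul_sq_of_nested_sqrt {b c : ℝ} (hb : 0 ≤ b) (hc : 0 ≤ c)
    (hD : 0 ≤ b ^ 2 - 4 * c) :
    √((b + √(b ^ 2 - 4 * c)) / 2) ^ 2 + √((b - √(b ^ 2 - 4 * c)) / 2) ^ 2 = b ∧
      √((b + √(b ^ 2 - 4 * c)) / 2) ^ 2 * √((b - √(b ^ 2 - 4 * c)) / 2) ^ 2 = c := by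
  have hle : √(b ^ 2 - 4 * c) ≤ b := Real.sqrt_le_iff.mpr ⟨hb, by linarith⟩
  rw [Real.sq_sqrt (by positivity), Real.sq_sqrt (by linarith)]
  refine ⟨by ring, ?_⟩
  linear_combination (-1 / 4 : ℝ) * Real.sq_sqrt hD

/-- A scalar is an eigenvalue of a matrix iff it is a root of its characteristic determinant. -/
theorem exists_mulVec_eq_smul_iff_det_eq_zero {K n : Type*} [Field K] [Fintype n] [DecidableEq n]
    (M : Matrix n n K) (μ : K) :
    (∃ v : n → K, v ≠ 0 ∧ M.mulVec v = μ • v) ↔ (μ • (1 : Matrix n n K) - M).det = 0 := by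
  rw [← Matrix.exists_mulVec_eq_zero_iff]
  simp only [Matrix.sub_mulVec, Matrix.smul_mulVec, Matrix.one_mulVec, sub_eq_zero, eq_comm]

/-- `λ ∈ ℂ` is an eigenvalue of the Hermitian matrix `iA` iff
`λ ∈ {ω₊, ω₋, −ω₋, −ω₊}`; consequently `ω·I₄ − iA` is invertible iff
`ω ∉ {ω₊, ω₋, −ω₋, −ω₊}`. -/
theorem stmt_2 (N Ω₁ Ω₂ Ω₃ f ωm ωp : ℝ) (hN : 0 < N)
    (hf : f = 2 * Real.sqrt (Ω₁ ^ 2 + Ω₂ ^ 2 + Ω₃ ^ 2))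
    (hωm : ωm = Real.sqrt ((N ^ 2 + f ^ 2 -
        Real.sqrt ((N ^ 2 + f ^ 2) ^ 2 - 16 * N ^ 2 * Ω₃ ^ 2)) / 2))
    (hωp : ωp = Real.sqrt ((N ^ 2 + f ^ 2 +
        Real.sqrt ((N ^ 2 + f ^ 2) ^ 2 - 16 * N ^ 2 * Ω₃ ^ 2)) / 2))
    (A : Matrix (Fin 4) (Fin 4) ℝ)
    (hA : A = !![0, -2*Ω₃, 2*Ω₂, 0;
                 2*Ω₃, 0, -2*Ω₁, 0;
                 -2*Ω₂, 2*Ω₁, 0, N;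
                 0, 0, -N, 0]) :
    (∀ lam : ℂ,
      (∃ v : Fin 4 → ℂ, v ≠ 0 ∧ (Complex.I • A.map Complex.ofReal).mulVec v = lam • v) ↔
        lam ∈ ({(ωp : ℂ), (ωm : ℂ), -(ωm : ℂ), -(ωp : ℂ)} : Set ℂ)) ∧
    (∀ ω : ℂ,
      IsUnit (ω • (1 : Matrix (Fin 4) (Fin 4) ℂ) - Complex.I • A.map Complex.ofReal) ↔
        ω ∉ ({(ωp : ℂ), (ωm : ℂ), -(ωm : ℂ), -(ωp : ℂ)} : Set ℂ)) := by
  have hf2 : f ^ 2 = 4 * (Ω₁ ^ 2 + Ω₂ ^ 2 + Ω₃ ^ 2) := by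
    rw [hf, mul_pow, Real.sq_sqrt (by positivity)]
    norm_num
  have hD : 0 ≤ (N ^ 2 + f ^ 2) ^ 2 - 4 * (4 * N ^ 2 * Ω₃ ^ 2) := by
    rw [hf2]
    nlinarith [sq_nonneg (N ^ 2 - 4 * (Ω₁ ^ 2 + Ω₂ ^ 2 + Ω₃ ^ 2)),
      mul_nonneg (sq_nonneg N) (sq_nonneg Ω₁), mul_nonneg (sq_nonneg N) (sq_nonneg Ω₂)]
  obtain ⟨hadd, hmul⟩ := sq_add_sq_and_sq_mul_sq_of_nested_sqrt
    (by positivity) (by positivity) hD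
  rw [show 4 * (4 * N ^ 2 * Ω₃ ^ 2) = 16 * N ^ 2 * Ω₃ ^ 2 by ring, ← hωp, ← hωm] at hadd hmul
  rw [hf2] at hadd
  have haddC : (ωp : ℂ) ^ 2 + (ωm : ℂ) ^ 2 =
      (N : ℂ) ^ 2 + 4 * ((Ω₁ : ℂ) ^ 2 + (Ω₂ : ℂ) ^ 2 + (Ω₃ : ℂ) ^ 2) := by exact_mod_cast hadd
  have hmulC : (ωp : ℂ) ^ 2 * (ωm : ℂ) ^ 2 = 4 * (N : ℂ) ^ 2 * (Ω₃ : ℂ) ^ 2 := by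
    exact_mod_cast hmul
  have hdet (z : ℂ) : (z • (1 : Matrix (Fin 4) (Fin 4) ℂ) - Complex.I • A.map Complex.ofReal).det =
      (z ^ 2 - (ωp : ℂ) ^ 2) * (z ^ 2 - (ωm : ℂ) ^ 2) := by
    have hpoly : (z ^ 2 - (ωp : ℂ) ^ 2) * (z ^ 2 - (ωm : ℂ) ^ 2) = z ^ 4 -
        ((N : ℂ) ^ 2 + 4 * ((Ω₁ : ℂ) ^ 2 + (Ω₂ : ℂ) ^ 2 + (Ω₃ : ℂ) ^ 2)) * z ^ 2 +
        4 * (N : ℂ) ^ 2 * (Ω₃ : ℂ) ^ 2 := by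
      linear_combination (-z ^ 2) * haddC + hmulC
    have hI4 : Complex.I ^ 4 = 1 := Complex.I_pow_four
    rw [hpoly, hA]
    simp [Matrix.det_succ_row_zero, Fin.sum_univ_succ, Fin.succAbove, Matrix.one_apply]
    ring_nf
    simp only [Complex.I_sq, hI4]
    ring
  have hroot (z : ℂ) :
      (z • (1 : Matrix (Fin 4) (Fin 4) ℂ) - Complex.I • A.map Complex.ofReal).det = 0 ↔
        z ∈ ({(ωp : ℂ), (ωm : ℂ), -(ωm : ℂ), -(ωp : ℂ)} : Set ℂ) := by
    rw [hdet, mul_eq_zero, sub_eq_zero, sub_eq_zero, sq_eq_sq_iff_eq_or_eq_neg,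
      sq_eq_sq_iff_eq_or_eq_neg]
    simp only [Set.mem_insert_iff, Set.mem_singleton_iff]
    tauto
  refine ⟨fun z => (exists_mulVec_eq_smul_iff_det_eq_zero _ z).trans (hroot z), fun z => ?_⟩
  rw [Matrix.isUnit_iff_isUnit_det, isUnit_iff_ne_zero]
  exact (hroot z).not
end

section
/- Let N > 0, Ω ∈ ℝ³, and A be the 4×4 matrix A = [[0, −2Ω₃, 2Ω₂, 0], [2Ω₃, 0, −2Ω₁, 0], [−2Ω₂, 2Ω₁, 0, N], [0, 0, −N, 0]]. For every v ∈ ℂ⁴ one has ‖(iA)v‖ ≤ ω₊‖v‖ (where ω₊ := √((N² + f² + √((N²+f²)² − 16N²Ω₃²))/2) and f := 2‖Ω‖), and there exists a nonzero v ∈ ℂ⁴ with ‖(iA)v‖ = ω₊‖v‖; i.e., the operator norm of iA on ℂ⁴ equals ω₊. -/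
lemma eq_zero_of_sum_four_sq {s t u v : ℝ} (h : s ^ 2 + t ^ 2 + u ^ 2 + v ^ 2 = 0) :
    s = 0 ∧ t = 0 ∧ u = 0 ∧ v = 0 := by
  refine ⟨?_, ?_, ?_, ?_⟩ <;> refine sq_eq_zero_iff.mp (le_antisymm ?_ (sq_nonneg _)) <;>
    linarith [sq_nonneg s, sq_nonneg t, sq_nonneg u, sq_nonneg v]

/-- If `l` is the larger root of `X² - (n² + a² + b² + c²) X + n² c²`, then `l` bounds the
quadratic form `x ↦ ‖A x‖²` of the antisymmetric matrix `A` with entries `a`, `b`, `c`, `n`. -/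
lemma sq_norm_antisymm_le (n a b c l : ℝ)
    (hl : l ^ 2 - (n ^ 2 + a ^ 2 + b ^ 2 + c ^ 2) * l + n ^ 2 * c ^ 2 = 0)
    (hS : n ^ 2 + a ^ 2 + b ^ 2 + c ^ 2 ≤ 2 * l) (x y z w : ℝ) :
    (b * z - c * y) ^ 2 + (c * x - a * z) ^ 2 + (a * y - b * x + n * w) ^ 2 + (n * z) ^ 2 ≤
      l * (x ^ 2 + y ^ 2 + z ^ 2 + w ^ 2) := by
  set p := b * z - c * y with hp
  set q := c * x - a * z with hq
  set r := a * y - b * x + n * w with hr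
  have key : (2 * l - (n ^ 2 + a ^ 2 + b ^ 2 + c ^ 2)) *
      (l * (x ^ 2 + y ^ 2 + z ^ 2 + w ^ 2) - (p ^ 2 + q ^ 2 + r ^ 2 + (n * z) ^ 2)) =
      (l * x - (c * q - b * r)) ^ 2 + (l * y - (a * r - c * p)) ^ 2 +
        (l * z - (b * p - a * q + n * (n * z))) ^ 2 + (l * w - n * r) ^ 2 := by
    simp only [hp, hq, hr]
    linear_combination (x ^ 2 + y ^ 2 + z ^ 2 + w ^ 2) * hl
  rcases hS.eq_or_lt with h | h
  · rw [h, sub_self, zero_mul] at key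
    obtain ⟨h1, h2, h3, h4⟩ := eq_zero_of_sum_four_sq key.symm
    apply le_of_eq
    simp only [hp, hq, hr] at h1 h2 h3 h4 ⊢
    linear_combination -x * h1 - y * h2 - z * h3 - w * h4
  · have : 0 ≤ l * (x ^ 2 + y ^ 2 + z ^ 2 + w ^ 2) - (p ^ 2 + q ^ 2 + r ^ 2 + (n * z) ^ 2) :=
        nonneg_of_mul_nonneg_right (by rw [key]; positivity) (sub_pos.mpr h)
    linarith

/-- The operator norm of `iA` on `ℂ⁴` (with the standard Hermitian norm)
equals `ω₊`: one has `‖(iA)v‖ ≤ ω₊‖v‖` for all `v`, with equality for some nonzero `v`. -/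
theorem stmt_3 (N Ω₁ Ω₂ Ω₃ f ωp : ℝ) (hN : 0 < N)
    (hf : f = 2 * Real.sqrt (Ω₁ ^ 2 + Ω₂ ^ 2 + Ω₃ ^ 2))
    (hωp : ωp = Real.sqrt ((N ^ 2 + f ^ 2 +
        Real.sqrt ((N ^ 2 + f ^ 2) ^ 2 - 16 * N ^ 2 * Ω₃ ^ 2)) / 2))
    (A : Matrix (Fin 4) (Fin 4) ℝ)
    (hA : A = !![0, -2*Ω₃, 2*Ω₂, 0;
                 2*Ω₃, 0, -2*Ω₁, 0;
                 -2*Ω₂, 2*Ω₁, 0, N;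
                 0, 0, -N, 0]) :
    (∀ v : EuclideanSpace ℂ (Fin 4),
      ‖Matrix.toEuclideanLin (Complex.I • A.map Complex.ofReal) v‖ ≤ ωp * ‖v‖) ∧
    (∃ v : EuclideanSpace ℂ (Fin 4), v ≠ 0 ∧
      ‖Matrix.toEuclideanLin (Complex.I • A.map Complex.ofReal) v‖ = ωp * ‖v‖) := by
  have hω : 0 ≤ ωp := hωp ▸ Real.sqrt_nonneg _
  have hf2 : f ^ 2 = (2 * Ω₁) ^ 2 + (2 * Ω₂) ^ 2 + (2 * Ω₃) ^ 2 := by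
    rw [hf, mul_pow, Real.sq_sqrt (by positivity)]; ring
  have hdisc : 0 ≤ (N ^ 2 + f ^ 2) ^ 2 - 16 * N ^ 2 * Ω₃ ^ 2 := by
    have : (N ^ 2 + f ^ 2) ^ 2 - 16 * N ^ 2 * Ω₃ ^ 2 =
        ((N - 2 * Ω₃) ^ 2 + (2 * Ω₁) ^ 2 + (2 * Ω₂) ^ 2) *
          ((N + 2 * Ω₃) ^ 2 + (2 * Ω₁) ^ 2 + (2 * Ω₂) ^ 2) := by
      rw [hf2]; ring
    rw [this]; positivity
  have hD := Real.sq_sqrt hdisc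
  have hD0 := Real.sqrt_nonneg ((N ^ 2 + f ^ 2) ^ 2 - 16 * N ^ 2 * Ω₃ ^ 2)
  have hω2 : ωp ^ 2 = (N ^ 2 + f ^ 2 +
      Real.sqrt ((N ^ 2 + f ^ 2) ^ 2 - 16 * N ^ 2 * Ω₃ ^ 2)) / 2 := by
    rw [hωp, Real.sq_sqrt (by positivity)]
  set D := Real.sqrt ((N ^ 2 + f ^ 2) ^ 2 - 16 * N ^ 2 * Ω₃ ^ 2)
  have hroot : (ωp ^ 2) ^ 2 - (N ^ 2 + (2 * Ω₁) ^ 2 + (2 * Ω₂) ^ 2 + (2 * Ω₃) ^ 2) * ωp ^ 2 +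
      N ^ 2 * (2 * Ω₃) ^ 2 = 0 := by
    have : N ^ 2 + (2 * Ω₁) ^ 2 + (2 * Ω₂) ^ 2 + (2 * Ω₃) ^ 2 = N ^ 2 + f ^ 2 := by
      rw [hf2]; ring
    rw [this, hω2]
    linear_combination hD / 4
  refine ⟨fun v => ?_, ?_⟩
  · have hbound := sq_norm_antisymm_le N (2 * Ω₁) (2 * Ω₂) (2 * Ω₃) (ωp ^ 2) hroot
      (by rw [hω2]; linarith)
    have hre := hbound (v 0).re (v 1).re (v 2).re (v 3).re
    have him := hbound (v 0).im (v 1).im (v 2).im (v 3).im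
    refine (sq_le_sq₀ (norm_nonneg _) (by positivity)).mp ?_
    rw [mul_pow, EuclideanSpace.norm_sq_eq, EuclideanSpace.norm_sq_eq]
    simp [hA, Fin.sum_univ_four, Complex.sq_norm, Complex.normSq_apply, Matrix.mulVec,
      dotProduct]
    linarith
  · have hdet : (Complex.I • A.map Complex.ofReal - Matrix.scalar (Fin 4) (ωp : ℂ)).det = 0 := by
      have hrootC : ((ωp : ℂ) ^ 2) ^ 2 - ((N : ℂ) ^ 2 + (2 * Ω₁) ^ 2 + (2 * Ω₂) ^ 2 +
          (2 * Ω₃) ^ 2) * (ωp : ℂ) ^ 2 + (N : ℂ) ^ 2 * (2 * Ω₃) ^ 2 = 0 := by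
        exact_mod_cast congrArg Complex.ofReal hroot
      rw [← hrootC, hA]
      simp [Matrix.det_succ_row_zero, Fin.sum_univ_succ, Fin.succAbove]
      ring_nf
      simp [Complex.I_sq, Complex.I_pow_four]
      ring
    obtain ⟨v, hv, hMv⟩ := Matrix.exists_mulVec_eq_zero_iff.mpr hdet
    rw [Matrix.sub_mulVec, sub_eq_zero] at hMv
    refine ⟨WithLp.toLp 2 v, by simpa using hv, ?_⟩
    have : Matrix.toEuclideanLin (Complex.I • A.map Complex.ofReal) (WithLp.toLp 2 v) =
        (ωp : ℂ) • WithLp.toLp 2 v := by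
      rw [Matrix.toLpLin_toLp, Matrix.toLin'_apply, hMv]
      ext i
      simp [Matrix.mulVec_diagonal]
    rw [this, norm_smul, Complex.norm_real, Real.norm_of_nonneg hω]
end

section
/- Let N > 0, Ω = (Ω₁, Ω₂, Ω₃) ∈ ℝ³, A the 4×4 matrix A = [[0, −2Ω₃, 2Ω₂, 0], [2Ω₃, 0, −2Ω₁, 0], [−2Ω₂, 2Ω₁, 0, N], [0, 0, −N, 0]], ω ∈ ℝ, and ξ = (ξ₁, ξ₂, ξ₃) ∈ ℝ³. Then the determinant of the 5×5 complex matrix obtained by bordering ω·I₄ − iA with the column (ξ₁, ξ₂, ξ₃, 0)ᵀ, the row (ξ₁, ξ₂, ξ₃, 0), and lower-right entry 0 equals σ_ω(ξ) := ω((N² − ω²)(ξ₁² + ξ₂² + ξ₃²) − N²ξ₃² + 4(Ω₁ξ₁ + Ω₂ξ₂ + Ω₃ξ₃)²), the principal symbol of the Poincaré operator. -/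
/-- The determinant of the 5×5 matrix obtained by bordering `ω·I₄ − iA`
with the column `(ξ₁, ξ₂, ξ₃, 0)ᵀ`, the row `(ξ₁, ξ₂, ξ₃, 0)` and lower-right entry `0`
equals the Poincaré symbol `σ_ω(ξ) = ω((N² − ω²)‖ξ‖² − N²ξ₃² + 4(Ω·ξ)²)`. -/
theorem stmt_4 (N Ω₁ Ω₂ Ω₃ ω ξ₁ ξ₂ ξ₃ : ℝ) (hN : 0 < N) :
    Matrix.det
      (!![(ω : ℂ), 2*Complex.I*(Ω₃ : ℂ), -2*Complex.I*(Ω₂ : ℂ), 0, (ξ₁ : ℂ);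
          -2*Complex.I*(Ω₃ : ℂ), (ω : ℂ), 2*Complex.I*(Ω₁ : ℂ), 0, (ξ₂ : ℂ);
          2*Complex.I*(Ω₂ : ℂ), -2*Complex.I*(Ω₁ : ℂ), (ω : ℂ), -Complex.I*(N : ℂ), (ξ₃ : ℂ);
          0, 0, Complex.I*(N : ℂ), (ω : ℂ), 0;
          (ξ₁ : ℂ), (ξ₂ : ℂ), (ξ₃ : ℂ), 0, 0] : Matrix (Fin 5) (Fin 5) ℂ) =
    ((ω * ((N ^ 2 - ω ^ 2) * (ξ₁ ^ 2 + ξ₂ ^ 2 + ξ₃ ^ 2) - N ^ 2 * ξ₃ ^ 2 +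
        4 * (Ω₁ * ξ₁ + Ω₂ * ξ₂ + Ω₃ * ξ₃) ^ 2) : ℝ) : ℂ) := by
  rw [Matrix.det_succ_column _ 3]
  simp [Fin.sum_univ_succ, Matrix.det_succ_row_zero, Matrix.submatrix, Fin.succAbove]
  linear_combination
    -((ω : ℂ) * ((N : ℂ) ^ 2 * ((ξ₁ : ℂ) ^ 2 + (ξ₂ : ℂ) ^ 2) +
      4 * ((Ω₁ : ℂ) * ξ₁ + (Ω₂ : ℂ) * ξ₂ + (Ω₃ : ℂ) * ξ₃) ^ 2)) * Complex.I_sq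
end

section
/- Let N > 0 and Ω = (Ω₁, Ω₂, Ω₃) ∈ ℝ³ with Ω₃ ≠ 0, let f := 2‖Ω‖ and ω₋ := √((N² + f² − √((N²+f²)² − 16N²Ω₃²))/2). If 0 < ω < ω₋, then the quadratic form σ_ω(ξ) := ω((N² − ω²)‖ξ‖² − N²ξ₃² + 4(Ω·ξ)²) is positive definite on ℝ³, i.e., σ_ω(ξ) > 0 for every ξ ∈ ℝ³ \ {0}. -/
/-- If `Ω₃ ≠ 0` and `0 < ω < ω₋`, the Poincaré symbol
`σ_ω(ξ) = ω((N² − ω²)‖ξ‖² − N²ξ₃² + 4(Ω·ξ)²)` is a positive definite quadratic form. -/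
theorem stmt_5 (N Ω₁ Ω₂ Ω₃ f ω : ℝ) (hN : 0 < N) (hΩ₃ : Ω₃ ≠ 0)
    (hf : f = 2 * Real.sqrt (Ω₁ ^ 2 + Ω₂ ^ 2 + Ω₃ ^ 2))
    (hω : 0 < ω)
    (hωm : ω < Real.sqrt ((N ^ 2 + f ^ 2 -
        Real.sqrt ((N ^ 2 + f ^ 2) ^ 2 - 16 * N ^ 2 * Ω₃ ^ 2)) / 2)) :
    ∀ ξ₁ ξ₂ ξ₃ : ℝ, (ξ₁, ξ₂, ξ₃) ≠ (0, 0, 0) →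
      0 < ω * ((N ^ 2 - ω ^ 2) * (ξ₁ ^ 2 + ξ₂ ^ 2 + ξ₃ ^ 2) - N ^ 2 * ξ₃ ^ 2 +
        4 * (Ω₁ * ξ₁ + Ω₂ * ξ₂ + Ω₃ * ξ₃) ^ 2) := by
  intro x y z hne
  have hF : f ^ 2 = 4 * (Ω₁ ^ 2 + Ω₂ ^ 2 + Ω₃ ^ 2) := by
    rw [hf, mul_pow, Real.sq_sqrt (by positivity)]
    norm_num
  have hlt := (Real.lt_sqrt hω.le).1 hωm
  set D := (N ^ 2 + f ^ 2) ^ 2 - 16 * N ^ 2 * Ω₃ ^ 2 with hD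
  have hS : Real.sqrt D < N ^ 2 + f ^ 2 - 2 * ω ^ 2 := by linarith
  have hT : 0 < N ^ 2 + f ^ 2 - 2 * ω ^ 2 := (Real.sqrt_nonneg D).trans_lt hS
  have hP : 0 < ω ^ 4 - (N ^ 2 + f ^ 2) * ω ^ 2 + 4 * N ^ 2 * Ω₃ ^ 2 := by
    have h := (Real.sqrt_lt' hT).1 hS
    rw [hD] at h
    nlinarith
  have ha : 0 < N ^ 2 - ω ^ 2 := by
    by_contra! h
    have h₁ : 0 ≤ (ω ^ 2 - N ^ 2) * (f ^ 2 - ω ^ 2) :=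
      mul_nonneg (by linarith) (by linarith)
    have h₂ : 0 ≤ N ^ 2 * (Ω₁ ^ 2 + Ω₂ ^ 2) := by positivity
    rw [hF] at hP h₁
    nlinarith
  refine mul_pos hω ?_
  by_cases hz : z = 0
  · subst hz
    have hxy : 0 < x ^ 2 + y ^ 2 := by
      by_cases hx : x = 0
      · have hy : y ≠ 0 := fun hy => hne (by simp [hx, hy])
        positivity
      · positivity
    have h := mul_pos ha hxy
    nlinarith [sq_nonneg (Ω₁ * x + Ω₂ * y)]
  · have hc : 0 < N ^ 2 - ω ^ 2 + 4 * (Ω₁ ^ 2 + Ω₂ ^ 2) := by positivity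
    refine pos_of_mul_pos_right (a := N ^ 2 - ω ^ 2 + 4 * (Ω₁ ^ 2 + Ω₂ ^ 2)) ?_ hc.le
    have key : (N ^ 2 - ω ^ 2 + 4 * (Ω₁ ^ 2 + Ω₂ ^ 2)) *
        ((N ^ 2 - ω ^ 2) * (x ^ 2 + y ^ 2 + z ^ 2) - N ^ 2 * z ^ 2 +
          4 * (Ω₁ * x + Ω₂ * y + Ω₃ * z) ^ 2) =
        4 * (N ^ 2 - ω ^ 2) * (Ω₁ * y - Ω₂ * x) ^ 2 +
        ((N ^ 2 - ω ^ 2) * x + 4 * (Ω₁ * x + Ω₂ * y + Ω₃ * z) * Ω₁) ^ 2 +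
        ((N ^ 2 - ω ^ 2) * y + 4 * (Ω₁ * x + Ω₂ * y + Ω₃ * z) * Ω₂) ^ 2 +
        z ^ 2 * (ω ^ 4 - (N ^ 2 + f ^ 2) * ω ^ 2 + 4 * N ^ 2 * Ω₃ ^ 2) := by
      rw [hF]
      ring
    rw [key]
    positivity
end

section
/- Let N > 0 and Ω = (Ω₁, Ω₂, Ω₃) ∈ ℝ³ with Ω₃ ≠ 0, f := 2‖Ω‖, and ω± := √((N² + f² ± √((N²+f²)² − 16N²Ω₃²))/2). For every ω > 0, there exists ξ ∈ ℝ³ \ {0} with σ_ω(ξ) = 0 if and only if ω₋ ≤ ω ≤ ω₊, where σ_ω(ξ) := ω((N² − ω²)‖ξ‖² − N²ξ₃² + 4(Ω·ξ)²). In other words, the Poincaré operator is elliptic exactly when 0 < ω < ω₋ or ω > ω₊. -/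
/-- The form `t‖ξ‖² - M ξ₃² + 4(Ω·ξ)²` with `Ω = (h p, h q, c)`, `p² + q² = 1`, has a nontrivial
zero if and only if its restriction to the plane spanned by `(p, q, 0)` and `(0, 0, 1)` has
nonpositive determinant. -/
theorem exists_zero_iff_det_nonpos {t M h c p q : ℝ} (hM : 0 ≤ M) (hpq : p ^ 2 + q ^ 2 = 1) :
    (∃ x y z : ℝ, (x, y, z) ≠ (0, 0, 0) ∧
        t * (x ^ 2 + y ^ 2 + z ^ 2) - M * z ^ 2 + 4 * (h * p * x + h * q * y + c * z) ^ 2 = 0) ↔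
      (t + 4 * h ^ 2) * (t - M + 4 * c ^ 2) - 16 * h ^ 2 * c ^ 2 ≤ 0 := by
  set D := t + 4 * h ^ 2 with hD
  set P := D * (t - M + 4 * c ^ 2) - 16 * h ^ 2 * c ^ 2 with hP
  constructor
  · rintro ⟨x, y, z, hne, hzero⟩
    by_contra! hpos
    have hPt : P = t * (t - M + 4 * c ^ 2) + 4 * h ^ 2 * (t - M) := by rw [hP, hD]; ring
    have htD : 0 < t * D := by
      rcases lt_trichotomy t 0 with ht | ht | ht
      · have hE : t - M + 4 * c ^ 2 < 0 := by
          by_contra! hE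
          nlinarith [mul_nonneg (neg_nonneg.2 ht.le) hE, mul_nonneg (sq_nonneg h) hM,
            mul_nonneg (sq_nonneg h) (neg_nonneg.2 ht.le)]
        have hD0 : D < 0 := by
          by_contra! hD0
          nlinarith [mul_nonneg hD0 (neg_nonneg.2 hE.le), mul_nonneg (sq_nonneg h) (sq_nonneg c)]
        exact mul_pos_of_neg_of_neg ht hD0
      · rw [ht] at hPt
        nlinarith [mul_nonneg (sq_nonneg h) hM]
      · exact mul_pos ht (by positivity)
    have hsum : t * D * (q * x - p * y) ^ 2 + (D * (p * x + q * y) + 4 * h * c * z) ^ 2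
        + P * z ^ 2 = 0 := by
      have hxy : x ^ 2 + y ^ 2 = (p * x + q * y) ^ 2 + (q * x - p * y) ^ 2 := by
        linear_combination -(x ^ 2 + y ^ 2) * hpq
      rw [hxy] at hzero
      rw [hP, hD]
      linear_combination (t + 4 * h ^ 2) * hzero
    have hv := mul_nonneg htD.le (sq_nonneg (q * x - p * y))
    have hu := sq_nonneg (D * (p * x + q * y) + 4 * h * c * z)
    have hw := mul_nonneg hpos.le (sq_nonneg z)
    have hz : z = 0 := by
      have : P * z ^ 2 = 0 := by linarith
      simpa [hpos.ne'] using this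
    have hv0 : q * x - p * y = 0 := by
      have : t * D * (q * x - p * y) ^ 2 = 0 := by linarith
      exact pow_eq_zero_iff two_ne_zero |>.1 ((mul_eq_zero.1 this).resolve_left htD.ne')
    have hu0 : p * x + q * y = 0 := by
      have : (D * (p * x + q * y) + 4 * h * c * z) ^ 2 = 0 := by linarith
      rw [hz, mul_zero, add_zero, pow_eq_zero_iff two_ne_zero] at this
      exact (mul_eq_zero.1 this).resolve_left (right_ne_zero_of_mul htD.ne')
    have hx : x = 0 := by linear_combination p * hu0 + q * hv0 - x * hpq
    have hy : y = 0 := by linear_combination q * hu0 - p * hv0 - y * hpq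
    exact hne (by rw [hx, hy, hz])
  · intro hneg
    by_cases hD0 : D = 0
    · refine ⟨p, q, 0, ?_, ?_⟩
      · intro h0
        simp only [Prod.mk.injEq] at h0
        simp [h0.1, h0.2.1] at hpq
      · linear_combination hD0 + (t + 4 * h ^ 2 * (p ^ 2 + q ^ 2 + 1)) * hpq + hD
    · have hr : √(-P) ^ 2 = -P := Real.sq_sqrt (by linarith)
      set r := √(-P)
      refine ⟨(r - 4 * h * c) * p, (r - 4 * h * c) * q, D, by simp [hD0], ?_⟩
      have hdot : h * p * ((r - 4 * h * c) * p) + h * q * ((r - 4 * h * c) * q) + c * D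
          = h * (r - 4 * h * c) + c * D := by
        linear_combination h * (r - 4 * h * c) * hpq
      have hnorm : ((r - 4 * h * c) * p) ^ 2 + ((r - 4 * h * c) * q) ^ 2
          = (r - 4 * h * c) ^ 2 := by
        linear_combination (r - 4 * h * c) ^ 2 * hpq
      rw [hdot, hnorm]
      linear_combination D * hr + D * hP - (r - 4 * h * c) ^ 2 * hD

/-- Location of `s` between the roots of `X² - B X + C`. -/
theorem between_roots_iff {B C s : ℝ} (hdisc : 0 ≤ B ^ 2 - 4 * C) :
    ((B - √(B ^ 2 - 4 * C)) / 2 ≤ s ∧ s ≤ (B + √(B ^ 2 - 4 * C)) / 2) ↔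
      s ^ 2 - B * s + C ≤ 0 := by
  have h : |2 * s - B| ≤ √(B ^ 2 - 4 * C) ↔ s ^ 2 - B * s + C ≤ 0 := by
    rw [Real.le_sqrt (abs_nonneg _) hdisc, sq_abs]
    constructor <;> intro h <;> linarith
  rw [← h, abs_le]
  constructor <;> rintro ⟨h₁, h₂⟩ <;> constructor <;> linarith

/-- For `Ω₃ ≠ 0` and `ω > 0`, the Poincaré symbol `σ_ω` has a nontrivial
real zero if and only if `ω₋ ≤ ω ≤ ω₊` (non-ellipticity exactly on `[ω₋, ω₊]`). -/
theorem stmt_6 (N Ω₁ Ω₂ Ω₃ f ωm ωp ω : ℝ) (hN : 0 < N) (hΩ₃ : Ω₃ ≠ 0)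
    (hf : f = 2 * Real.sqrt (Ω₁ ^ 2 + Ω₂ ^ 2 + Ω₃ ^ 2))
    (hωm : ωm = Real.sqrt ((N ^ 2 + f ^ 2 -
        Real.sqrt ((N ^ 2 + f ^ 2) ^ 2 - 16 * N ^ 2 * Ω₃ ^ 2)) / 2))
    (hωp : ωp = Real.sqrt ((N ^ 2 + f ^ 2 +
        Real.sqrt ((N ^ 2 + f ^ 2) ^ 2 - 16 * N ^ 2 * Ω₃ ^ 2)) / 2))
    (hω : 0 < ω) :
    (∃ ξ₁ ξ₂ ξ₃ : ℝ, (ξ₁, ξ₂, ξ₃) ≠ (0, 0, 0) ∧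
        ω * ((N ^ 2 - ω ^ 2) * (ξ₁ ^ 2 + ξ₂ ^ 2 + ξ₃ ^ 2) - N ^ 2 * ξ₃ ^ 2 +
          4 * (Ω₁ * ξ₁ + Ω₂ * ξ₂ + Ω₃ * ξ₃) ^ 2) = 0) ↔
      (ωm ≤ ω ∧ ω ≤ ωp) := by
  obtain ⟨h, p, q, hpq, rfl, rfl⟩ :
      ∃ h p q : ℝ, p ^ 2 + q ^ 2 = 1 ∧ Ω₁ = h * p ∧ Ω₂ = h * q :=
    ⟨‖(⟨Ω₁, Ω₂⟩ : ℂ)‖, Real.cos (Complex.arg ⟨Ω₁, Ω₂⟩), Real.sin (Complex.arg ⟨Ω₁, Ω₂⟩),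
      Real.cos_sq_add_sin_sq _, (Complex.norm_mul_cos_arg ⟨Ω₁, Ω₂⟩).symm,
      (Complex.norm_mul_sin_arg ⟨Ω₁, Ω₂⟩).symm⟩
  have hf2 : f ^ 2 = 4 * (h ^ 2 + Ω₃ ^ 2) := by
    rw [hf, mul_pow, Real.sq_sqrt (by positivity)]
    linear_combination 4 * h ^ 2 * hpq
  have hdisc : 0 ≤ (N ^ 2 + f ^ 2) ^ 2 - 4 * (4 * N ^ 2 * Ω₃ ^ 2) := by
    rw [hf2]
    nlinarith [sq_nonneg (N ^ 2 - 4 * (h ^ 2 + Ω₃ ^ 2)), mul_nonneg (sq_nonneg N) (sq_nonneg h)]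
  have hC : 16 * N ^ 2 * Ω₃ ^ 2 = 4 * (4 * N ^ 2 * Ω₃ ^ 2) := by ring
  rw [hωm, hωp, Real.sqrt_le_left hω.le, Real.le_sqrt' hω, hC, between_roots_iff hdisc]
  simp only [mul_eq_zero, hω.ne', false_or]
  rw [exists_zero_iff_det_nonpos (sq_nonneg N) hpq, hf2]
  ring_nf
end

section
/- Let N > 0, f > 0, 0 < ω < min(N, f), and φ ∈ ℝ. Then the ellipticity condition of the Kelvin equation at latitude φ, namely f²(N² − ω²)²cos²φ/(ω(N² − ω²)) < ω((N² − ω²)cos²φ + (f² − ω²)sin²φ), holds if and only if N²cos²φ < ω². In particular the Kelvin equation is elliptic exactly at latitudes with |cos φ| < ω/N, and it is never elliptic at the equator φ = 0. -/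
/-- For `0 < ω < min(N, f)`, the ellipticity condition at latitude `φ` amounts to
`N²cos²φ < ω²`. -/
lemma kelvin_elliptic_iff {N f ω : ℝ} (hω : 0 < ω) (hωN : ω < N) (hωf : ω < f) (φ : ℝ) :
    (f ^ 2 * (N ^ 2 - ω ^ 2) ^ 2 * Real.cos φ ^ 2 / (ω * (N ^ 2 - ω ^ 2)) <
        ω * ((N ^ 2 - ω ^ 2) * Real.cos φ ^ 2 + (f ^ 2 - ω ^ 2) * Real.sin φ ^ 2)) ↔
      N ^ 2 * Real.cos φ ^ 2 < ω ^ 2 := by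
  have hA : 0 < N ^ 2 - ω ^ 2 := sub_pos.mpr (pow_lt_pow_left₀ hωN hω.le two_ne_zero)
  have hB : 0 < f ^ 2 - ω ^ 2 := sub_pos.mpr (pow_lt_pow_left₀ hωf hω.le two_ne_zero)
  rw [div_lt_iff₀ (mul_pos hω hA), Real.sin_sq, ← sub_pos, ← sub_pos (a := ω ^ 2),
    ← mul_pos_iff_of_pos_left (mul_pos hA hB) (b := ω ^ 2 - N ^ 2 * Real.cos φ ^ 2)]
  ring_nf


/-- In the aligned case, for `0 < ω < min(N, f)`, the ellipticity condition
`‖W₁‖²_ω < σ_ω(a)` of the Kelvin equation at latitude `φ` holds iff `N²cos²φ < ω²`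
(equivalently `|cos φ| < ω/N`); in particular it never holds at the equator `φ = 0`. -/
theorem stmt_13 (N f ω φ : ℝ) (hN : 0 < N) (hf : 0 < f)
    (hω : 0 < ω) (hω' : ω < min N f) :
    ((f ^ 2 * (N ^ 2 - ω ^ 2) ^ 2 * Real.cos φ ^ 2 / (ω * (N ^ 2 - ω ^ 2)) <
        ω * ((N ^ 2 - ω ^ 2) * Real.cos φ ^ 2 + (f ^ 2 - ω ^ 2) * Real.sin φ ^ 2)) ↔
      N ^ 2 * Real.cos φ ^ 2 < ω ^ 2) ∧
    ((f ^ 2 * (N ^ 2 - ω ^ 2) ^ 2 * Real.cos φ ^ 2 / (ω * (N ^ 2 - ω ^ 2)) <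
        ω * ((N ^ 2 - ω ^ 2) * Real.cos φ ^ 2 + (f ^ 2 - ω ^ 2) * Real.sin φ ^ 2)) ↔
      |Real.cos φ| < ω / N) ∧
    ¬ (f ^ 2 * (N ^ 2 - ω ^ 2) ^ 2 * Real.cos (0 : ℝ) ^ 2 / (ω * (N ^ 2 - ω ^ 2)) <
        ω * ((N ^ 2 - ω ^ 2) * Real.cos (0 : ℝ) ^ 2 +
          (f ^ 2 - ω ^ 2) * Real.sin (0 : ℝ) ^ 2)) := by
  obtain ⟨hωN, hωf⟩ := lt_min_iff.mp hω'
  refine ⟨kelvin_elliptic_iff hω hωN hωf φ, ?_, ?_⟩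
  · rw [kelvin_elliptic_iff hω hωN hωf φ, lt_div_iff₀ hN, ← mul_pow,
      sq_lt_sq, abs_mul, abs_of_pos hN, abs_of_pos hω, mul_comm]
  · rw [kelvin_elliptic_iff hω hωN hωf 0, Real.cos_zero, one_pow, mul_one, not_lt]
    exact pow_le_pow_left₀ hω.le hωN.le 2
end

section
/- Let N > 0, Ω₁, Ω₃ ∈ ℝ, f² := 4(Ω₁² + Ω₃²), and 0 < ω < N. Then the ellipticity condition 4Ω₁²ω⁴/(ω(N² − ω²)) < ω(4Ω₃² − ω²) holds if and only if (ω² − ω₋²)(ω² − ω₊²) > 0, where ω± := √((N² + f² ± √((N²+f²)² − 16N²Ω₃²))/2). In particular, the condition is satisfied whenever 0 < ω < ω₋, so there are no gravito-inertial surface waves at boundary points where the stratification is parallel to the tangent plane. -/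
/-- The discriminant of the quadratic `x² - (N² + f²) x + 4 N² Ω₃²` is nonnegative. -/
theorem discriminant_nonneg {N Ω₁ Ω₃ f : ℝ} (hf : f ^ 2 = 4 * (Ω₁ ^ 2 + Ω₃ ^ 2)) :
    0 ≤ (N ^ 2 + f ^ 2) ^ 2 - 16 * N ^ 2 * Ω₃ ^ 2 := by
  have h : (N ^ 2 + f ^ 2) ^ 2 - 16 * N ^ 2 * Ω₃ ^ 2 =
      (N ^ 2 - f ^ 2) ^ 2 + 16 * (N * Ω₁) ^ 2 := by
    rw [hf]; ring
  rw [h]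
  positivity

/-- For `0 < ω < N`, ellipticity is positivity of a quadratic polynomial in `ω²`. -/
theorem ellipticity_iff_quadratic_pos {N Ω₁ Ω₃ ω f : ℝ}
    (hf : f ^ 2 = 4 * (Ω₁ ^ 2 + Ω₃ ^ 2)) (hω : 0 < ω) (hωN : ω < N) :
    4 * Ω₁ ^ 2 * ω ^ 4 / (ω * (N ^ 2 - ω ^ 2)) < ω * (4 * Ω₃ ^ 2 - ω ^ 2) ↔
      0 < (ω ^ 2) ^ 2 - (N ^ 2 + f ^ 2) * ω ^ 2 + 4 * N ^ 2 * Ω₃ ^ 2 := by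
  have hgap : 0 < N ^ 2 - ω ^ 2 := by nlinarith
  have hdiff : ω * (4 * Ω₃ ^ 2 - ω ^ 2) * (ω * (N ^ 2 - ω ^ 2)) - 4 * Ω₁ ^ 2 * ω ^ 4 =
      ω ^ 2 * ((ω ^ 2) ^ 2 - (N ^ 2 + f ^ 2) * ω ^ 2 + 4 * N ^ 2 * Ω₃ ^ 2) := by
    rw [hf]; ring
  rw [div_lt_iff₀ (mul_pos hω hgap), ← sub_pos, hdiff, mul_pos_iff_of_pos_left (pow_pos hω 2)]

/-- At boundary points with horizontal tangent plane (conormal `(0,0,1)`),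
for `0 < ω < N` the ellipticity condition `4Ω₁²ω⁴/(ω(N² − ω²)) < ω(4Ω₃² − ω²)` holds
iff `(ω² − ω₋²)(ω² − ω₊²) > 0`; in particular it holds whenever `0 < ω < ω₋`:
no gravito-inertial surface waves there. -/
theorem stmt_14 (N Ω₁ Ω₃ ω f ωm ωp : ℝ) (hN : 0 < N)
    (hf : f ^ 2 = 4 * (Ω₁ ^ 2 + Ω₃ ^ 2))
    (hω : 0 < ω) (hωN : ω < N)
    (hωm : ωm = Real.sqrt ((N ^ 2 + f ^ 2 -
        Real.sqrt ((N ^ 2 + f ^ 2) ^ 2 - 16 * N ^ 2 * Ω₃ ^ 2)) / 2))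
    (hωp : ωp = Real.sqrt ((N ^ 2 + f ^ 2 +
        Real.sqrt ((N ^ 2 + f ^ 2) ^ 2 - 16 * N ^ 2 * Ω₃ ^ 2)) / 2)) :
    ((4 * Ω₁ ^ 2 * ω ^ 4 / (ω * (N ^ 2 - ω ^ 2)) < ω * (4 * Ω₃ ^ 2 - ω ^ 2)) ↔
      0 < (ω ^ 2 - ωm ^ 2) * (ω ^ 2 - ωp ^ 2)) ∧
    (ω < ωm →
      4 * Ω₁ ^ 2 * ω ^ 4 / (ω * (N ^ 2 - ω ^ 2)) < ω * (4 * Ω₃ ^ 2 - ω ^ 2)) := by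
  have hD := discriminant_nonneg (N := N) hf
  set D := (N ^ 2 + f ^ 2) ^ 2 - 16 * N ^ 2 * Ω₃ ^ 2 with hDdef
  have hs : Real.sqrt D ^ 2 = D := Real.sq_sqrt hD
  have hs0 : 0 ≤ Real.sqrt D := Real.sqrt_nonneg D
  have hsle : Real.sqrt D ≤ N ^ 2 + f ^ 2 :=
    Real.sqrt_le_iff.mpr ⟨by positivity, sub_le_self _ (by positivity)⟩
  have hm : ωm ^ 2 = (N ^ 2 + f ^ 2 - Real.sqrt D) / 2 := by
    rw [hωm, Real.sq_sqrt (by linarith)]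
  have hp : ωp ^ 2 = (N ^ 2 + f ^ 2 + Real.sqrt D) / 2 := by
    rw [hωp, Real.sq_sqrt (by positivity)]
  have hfactor : (ω ^ 2 - ωm ^ 2) * (ω ^ 2 - ωp ^ 2) =
      (ω ^ 2) ^ 2 - (N ^ 2 + f ^ 2) * ω ^ 2 + 4 * N ^ 2 * Ω₃ ^ 2 := by
    rw [hm, hp]
    linear_combination (-1 / 4) * hs - (1 / 4) * hDdef
  have hiff := ellipticity_iff_quadratic_pos hf hω hωN
  rw [← hfactor] at hiff
  refine ⟨hiff, fun hlt => hiff.mpr ?_⟩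
  have hsq : ω ^ 2 < ωm ^ 2 := pow_lt_pow_left₀ hlt hω.le two_ne_zero
  exact mul_pos_of_neg_of_neg (by linarith) (by linarith)
end

section
/- Let N > 0, Ω₁, Ω₃ ∈ ℝ with Ω₃ ≠ 0, f² := 4(Ω₁² + Ω₃²), and ω > 0. Then 4(N² − ω²)Ω₃² < ω²(N² + 4Ω₁² − ω²) if and only if (ω² − ω₋²)(ω² − ω₊²) < 0, where ω± := √((N² + f² ± √((N²+f²)² − 16N²Ω₃²))/2). In particular, for 0 < ω < ω₋ the ellipticity condition fails, so the Kelvin equation is non-elliptic and there are always gravito-inertial surface waves located near the equator, where the stratification is orthogonal to the boundary. -/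
/-- At boundary points where the stratification is orthogonal to the
boundary (conormal `(1,0,0)`), for `ω > 0` the inequality
`4(N² − ω²)Ω₃² < ω²(N² + 4Ω₁² − ω²)` holds iff `(ω² − ω₋²)(ω² − ω₊²) < 0`; in particular
for `0 < ω < ω₋` the ellipticity condition fails: there are always surface waves. -/
theorem stmt_15 (N Ω₁ Ω₃ ω f ωm ωp : ℝ) (hN : 0 < N) (hΩ₃ : Ω₃ ≠ 0)
    (hf : f ^ 2 = 4 * (Ω₁ ^ 2 + Ω₃ ^ 2)) (hω : 0 < ω)
    (hωm : ωm = Real.sqrt ((N ^ 2 + f ^ 2 -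
        Real.sqrt ((N ^ 2 + f ^ 2) ^ 2 - 16 * N ^ 2 * Ω₃ ^ 2)) / 2))
    (hωp : ωp = Real.sqrt ((N ^ 2 + f ^ 2 +
        Real.sqrt ((N ^ 2 + f ^ 2) ^ 2 - 16 * N ^ 2 * Ω₃ ^ 2)) / 2)) :
    ((4 * (N ^ 2 - ω ^ 2) * Ω₃ ^ 2 < ω ^ 2 * (N ^ 2 + 4 * Ω₁ ^ 2 - ω ^ 2)) ↔
      (ω ^ 2 - ωm ^ 2) * (ω ^ 2 - ωp ^ 2) < 0) ∧
    (ω < ωm →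
      ¬ (4 * (N ^ 2 - ω ^ 2) * Ω₃ ^ 2 < ω ^ 2 * (N ^ 2 + 4 * Ω₁ ^ 2 - ω ^ 2))) := by
  have hdisc : 0 ≤ (N ^ 2 + f ^ 2) ^ 2 - 16 * N ^ 2 * Ω₃ ^ 2 := by
    rw [hf]
    nlinarith [sq_nonneg (N ^ 2 - 4 * (Ω₁ ^ 2 + Ω₃ ^ 2)), sq_nonneg (N * Ω₁)]
  set s := Real.sqrt ((N ^ 2 + f ^ 2) ^ 2 - 16 * N ^ 2 * Ω₃ ^ 2) with hs
  have hs0 : 0 ≤ s := Real.sqrt_nonneg _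
  have hs2 : s ^ 2 = (N ^ 2 + f ^ 2) ^ 2 - 16 * N ^ 2 * Ω₃ ^ 2 := Real.sq_sqrt hdisc
  have hsum : 0 ≤ N ^ 2 + f ^ 2 := by positivity
  have hle : s ≤ N ^ 2 + f ^ 2 :=
    abs_le_of_sq_le_sq' (by rw [hs2]; nlinarith [sq_nonneg (N * Ω₃)]) hsum |>.2
  have hm2 : ωm ^ 2 = (N ^ 2 + f ^ 2 - s) / 2 := by
    rw [hωm, Real.sq_sqrt (by linarith)]
  have hp2 : ωp ^ 2 = (N ^ 2 + f ^ 2 + s) / 2 := by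
    rw [hωp, Real.sq_sqrt (by linarith)]
  have hfactor : (ω ^ 2 - ωm ^ 2) * (ω ^ 2 - ωp ^ 2) =
      4 * (N ^ 2 - ω ^ 2) * Ω₃ ^ 2 - ω ^ 2 * (N ^ 2 + 4 * Ω₁ ^ 2 - ω ^ 2) := by
    rw [hm2, hp2]
    linear_combination (-1 / 4) * hs2 - ω ^ 2 * hf
  have hiff : (4 * (N ^ 2 - ω ^ 2) * Ω₃ ^ 2 < ω ^ 2 * (N ^ 2 + 4 * Ω₁ ^ 2 - ω ^ 2)) ↔
      (ω ^ 2 - ωm ^ 2) * (ω ^ 2 - ωp ^ 2) < 0 := by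
    rw [hfactor, sub_neg]
  refine ⟨hiff, fun hlt => ?_⟩
  rw [hiff, not_lt]
  have hωm2 : ω ^ 2 < ωm ^ 2 := pow_lt_pow_left₀ hlt hω.le two_ne_zero
  exact mul_nonneg_of_nonpos_of_nonpos (by linarith) (by linarith)
end

section
/- Let n ≥ 1 be an integer and let φ: ℝ³ → ℝ be a polynomial function of degree at most n + 1 such that each component of its gradient satisfies the Legendre eigenvalue equation 𝓛(∂ⱼφ) = n(n + 3)·∂ⱼφ for j = 1, 2, 3, where 𝓛ψ := −Δψ − L*(Lψ), L := Σᵢ xᵢ∂ᵢ, and L* := −L − 3. Then there exist a homogeneous polynomial h of degree n + 1 in three variables with Δh = 0 (a harmonic homogeneous polynomial, i.e., a solid spherical harmonic of degree n + 1) and a constant c ∈ ℝ such that φ(x) = h(x) + c for every x ∈ ℝ³ with ‖x‖ = 1. In other words, the restriction of the pressure to the unit sphere is a spherical harmonic of degree n + 1 up to a constant. -/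
/-- Partial derivative `∂ⱼψ` of a function `ψ : ℝ³ → ℝ`. -/
noncomputable def pd (j : Fin 3) (ψ : (Fin 3 → ℝ) → ℝ) : (Fin 3 → ℝ) → ℝ :=
  fun x => fderiv ℝ ψ x (Pi.single j 1)

/-- The Euler (radial) operator `L = Σᵢ xᵢ∂ᵢ`. -/
noncomputable def eulerOp (ψ : (Fin 3 → ℝ) → ℝ) : (Fin 3 → ℝ) → ℝ :=
  fun x => ∑ i : Fin 3, x i * pd i ψ x

/-- The Euclidean Laplacian `Δ = Σᵢ ∂ᵢ²` on `ℝ³`. -/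
noncomputable def lapOp (ψ : (Fin 3 → ℝ) → ℝ) : (Fin 3 → ℝ) → ℝ :=
  fun x => ∑ i : Fin 3, pd i (pd i ψ) x

/-- The formal adjoint `L* = −L − 3` of the Euler operator. -/
noncomputable def eulerStar (ψ : (Fin 3 → ℝ) → ℝ) : (Fin 3 → ℝ) → ℝ :=
  fun x => -(eulerOp ψ x) - 3 * ψ x

/-- The Legendre operator `𝓛 = −Δ − L*L`. -/
noncomputable def legendreOp (ψ : (Fin 3 → ℝ) → ℝ) : (Fin 3 → ℝ) → ℝ :=
  fun x => -(lapOp ψ x) - eulerStar (eulerOp ψ) x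

open MvPolynomial in
/-- The partial derivatives of a polynomial function are given by `MvPolynomial.pderiv`. -/
theorem pd_eval (j : Fin 3) (p : MvPolynomial (Fin 3) ℝ) :
    pd j (fun y => eval y p) = fun y => eval y (pderiv j p) := by
  funext x
  have hd : ∀ q : MvPolynomial (Fin 3) ℝ, DifferentiableAt ℝ (fun y => eval y q) x := fun q =>
    (AnalyticOnNhd.eval_mvPolynomial (𝕜 := ℝ) q x (Set.mem_univ x)).differentiableAt
  unfold pd
  induction p using MvPolynomial.induction_on with
  | C a => simp
  | add p q hp hq =>
    simp only [map_add, ← hp, ← hq]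
    rw [fderiv_fun_add (hd p) (hd q)]
    simp
  | mul_X p i hp =>
    have hX : HasFDerivAt (fun y : Fin 3 → ℝ => y i)
        (ContinuousLinearMap.proj (R := ℝ) (φ := fun _ : Fin 3 => ℝ) i) x :=
      (ContinuousLinearMap.proj (R := ℝ) (φ := fun _ : Fin 3 => ℝ) i).hasFDerivAt
    simp only [map_mul, eval_X]
    rw [fderiv_fun_mul (hd p) hX.differentiableAt, hX.fderiv]
    simp only [add_apply, smul_apply, hp,
      ContinuousLinearMap.proj_apply, smul_eq_mul, Derivation.leibniz, map_add, map_mul, eval_X,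
      pderiv_X]
    by_cases hij : i = j
    · subst hij; simp
    · simp [hij]

namespace MvPolynomial

section CommSemiring

variable {σ R : Type*} [CommSemiring R]

theorem pderiv_comm (i j : σ) (p : MvPolynomial σ R) :
    pderiv i (pderiv j p) = pderiv j (pderiv i p) := by
  classical
  ext m
  by_cases hij : i = j
  · rw [hij]
  · simp only [coeff_pderiv, add_right_comm m (Finsupp.single i 1), Finsupp.add_apply,
      Finsupp.single_eq_of_ne hij, Finsupp.single_eq_of_ne (Ne.symm hij), add_zero]
    ring

theorem homogeneousComponent_pderiv (k : ℕ) (i : σ) (p : MvPolynomial σ R) :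
    homogeneousComponent k (pderiv i p) = pderiv i (homogeneousComponent (k + 1) p) := by
  ext m
  simp only [coeff_homogeneousComponent, coeff_pderiv, map_add, Finsupp.degree_single,
    add_left_inj, ite_mul, zero_mul]

end CommSemiring

variable {σ : Type*} [Fintype σ]

/-- The Euler derivation `∑ i, X i * ∂ i`. -/
noncomputable def eulerDer : MvPolynomial σ ℝ →ₗ[ℝ] MvPolynomial σ ℝ :=
  ∑ i, LinearMap.mulLeft ℝ (X i) ∘ₗ (pderiv i : Derivation ℝ _ (MvPolynomial σ ℝ)).toLinearMap

/-- The Laplacian `∑ i, ∂ i ∂ i`. -/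
noncomputable def laplace : MvPolynomial σ ℝ →ₗ[ℝ] MvPolynomial σ ℝ :=
  ∑ i, (pderiv i : Derivation ℝ _ (MvPolynomial σ ℝ)).toLinearMap ∘ₗ
    (pderiv i : Derivation ℝ _ (MvPolynomial σ ℝ)).toLinearMap

theorem eulerDer_apply (p : MvPolynomial σ ℝ) : eulerDer p = ∑ i, X i * pderiv i p := by
  simp [eulerDer]

theorem laplace_apply (p : MvPolynomial σ ℝ) : laplace p = ∑ i, pderiv i (pderiv i p) := by
  simp [laplace]

theorem IsHomogeneous.eulerDer_eq {k : ℕ} {p : MvPolynomial σ ℝ} (hp : p.IsHomogeneous k) :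
    eulerDer p = (k : ℝ) • p := by
  rw [eulerDer_apply, hp.sum_X_mul_pderiv, Nat.cast_smul_eq_nsmul]

theorem homogeneousComponent_eulerDer (k : ℕ) (p : MvPolynomial σ ℝ) :
    homogeneousComponent k (eulerDer p) = (k : ℝ) • homogeneousComponent k p := by
  conv_lhs => rw [← sum_homogeneousComponent p]
  conv_rhs => rw [← sum_homogeneousComponent p]
  simp only [map_sum, Finset.smul_sum]
  refine Finset.sum_congr rfl fun j _ => ?_
  have hj := homogeneousComponent_isHomogeneous j p
  rw [hj.eulerDer_eq, map_smul, homogeneousComponent_of_mem hj]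
  split_ifs with h
  · rw [h]
  · simp

theorem homogeneousComponent_laplace (k : ℕ) (p : MvPolynomial σ ℝ) :
    homogeneousComponent k (laplace p) = laplace (homogeneousComponent (k + 2) p) := by
  simp only [laplace_apply, map_sum, homogeneousComponent_pderiv]

theorem eulerDer_pderiv (j : σ) (p : MvPolynomial σ ℝ) :
    eulerDer (pderiv j p) = pderiv j (eulerDer p) - pderiv j p := by
  classical
  simp only [eulerDer_apply, map_sum, Derivation.leibniz, pderiv_X, smul_eq_mul,
    Finset.sum_add_distrib, pderiv_comm j]
  simp [Pi.single_apply]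

theorem laplace_pderiv (j : σ) (p : MvPolynomial σ ℝ) :
    laplace (pderiv j p) = pderiv j (laplace p) := by
  simp only [laplace_apply, map_sum, pderiv_comm j]

theorem homogeneousComponent_eq_zero_of_pderiv_eq_zero {p : MvPolynomial σ ℝ}
    (hp : ∀ i, pderiv i p = 0) {k : ℕ} (hk : k ≠ 0) : homogeneousComponent k p = 0 := by
  have h := homogeneousComponent_eulerDer k p
  simpa [eulerDer_apply, hp, hk] using h.symm

theorem eq_C_of_pderiv_eq_zero {p : MvPolynomial σ ℝ} (hp : ∀ i, pderiv i p = 0) :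
    p = C (coeff 0 p) := by
  conv_lhs => rw [← sum_homogeneousComponent p]
  rw [Finset.sum_eq_single 0 (fun k _ hk => homogeneousComponent_eq_zero_of_pderiv_eq_zero hp hk)
    (by simp), homogeneousComponent_zero]

theorem IsHomogeneous.laplace_eq_zero {k : ℕ} (hk : k ≤ 1) {p : MvPolynomial σ ℝ}
    (hp : p.IsHomogeneous k) : laplace p = 0 := by
  rw [laplace_apply]
  refine Finset.sum_eq_zero fun i _ => ?_
  have h : (pderiv i p).IsHomogeneous 0 := by
    simpa [Nat.sub_eq_zero_of_le hk] using hp.pderiv (i := i)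
  rw [← totalDegree_zero_iff_isHomogeneous, totalDegree_eq_zero_iff_eq_C] at h
  rw [h, pderiv_C]

/-- The squared Euclidean norm as a polynomial in three variables. -/
noncomputable def normSqPoly : MvPolynomial (Fin 3) ℝ := ∑ i, X i ^ 2

theorem isHomogeneous_normSqPoly : normSqPoly.IsHomogeneous 2 :=
  IsHomogeneous.sum _ _ _ fun i _ => by simpa using (isHomogeneous_X ℝ i).pow 2

theorem isHomogeneous_normSqPoly_pow_mul {k : ℕ} (j : ℕ) {p : MvPolynomial (Fin 3) ℝ}
    (hp : p.IsHomogeneous k) : (normSqPoly ^ j * p).IsHomogeneous (2 * j + k) :=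
  (isHomogeneous_normSqPoly.pow j).mul hp

theorem laplace_normSqPoly_mul (p : MvPolynomial (Fin 3) ℝ) :
    laplace (normSqPoly * p) =
      (6 : ℝ) • p + (4 : ℝ) • eulerDer p + normSqPoly * laplace p := by
  simp only [laplace_apply, eulerDer_apply, normSqPoly, Fin.sum_univ_three, pderiv_mul, map_add,
    pderiv_pow, pderiv_X, smul_eq_C_mul, map_ofNat]
  have h2 : ∀ i : Fin 3, pderiv i (2 : MvPolynomial (Fin 3) ℝ) = 0 := fun i => by
    rw [← map_ofNat C 2, pderiv_C]
  simp [h2]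
  ring

theorem laplace_normSqPoly_pow_mul {k : ℕ} (j : ℕ) {p : MvPolynomial (Fin 3) ℝ}
    (hp : p.IsHomogeneous k) :
    laplace (normSqPoly ^ (j + 1) * p) = normSqPoly ^ (j + 1) * laplace p +
      ((2 * (j + 1) * (2 * (j + 1) + 1 + 2 * k) : ℝ)) • (normSqPoly ^ j * p) := by
  have key : ∀ i : ℕ, laplace (normSqPoly ^ (i + 1) * p) =
      (6 + 4 * (2 * i + k) : ℝ) • (normSqPoly ^ i * p) +
        normSqPoly * laplace (normSqPoly ^ i * p) := fun i => by
    rw [pow_succ', mul_assoc, laplace_normSqPoly_mul,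
      (isHomogeneous_normSqPoly_pow_mul i hp).eulerDer_eq]
    push_cast
    module
  induction j with
  | zero =>
    rw [key]
    simp only [pow_zero, one_mul, zero_add, pow_one, Nat.cast_zero]
    module
  | succ j ih =>
    rw [key, ih, mul_add normSqPoly, mul_smul_comm, ← mul_assoc, ← mul_assoc, ← pow_succ',
      ← pow_succ']
    push_cast
    module

end MvPolynomial

theorem Finset.sum_range_eq_sum_even {M : Type*} [AddCommMonoid M] (N : ℕ) (g : ℕ → M)
    (hg : ∀ j ≤ N, Odd j → g j = 0) :
    ∑ j ∈ Finset.range (N + 1), g j = ∑ j ∈ Finset.range (N / 2 + 1), g (2 * j) := by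
  symm
  refine Finset.sum_of_injOn (fun j => 2 * j) (fun a _ b _ h => by simpa using h) ?_ ?_
    (fun _ _ => rfl)
  · intro j hj
    simp only [Finset.coe_range, Set.mem_Iio] at hj ⊢
    omega
  · intro j hj hj'
    rw [Finset.mem_range] at hj
    refine hg j (by omega) (Nat.not_even_iff_odd.1 fun ⟨r, hr⟩ => hj' ⟨r, ?_, ?_⟩)
    · simp only [Finset.coe_range, Set.mem_Iio]
      omega
    · simp only
      omega

namespace MvPolynomial

theorem legendreOp_eval (q : MvPolynomial (Fin 3) ℝ) (x : Fin 3 → ℝ) :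
    legendreOp (fun y => eval y q) x =
      eval x (eulerDer (eulerDer q) + (3 : ℝ) • eulerDer q - laplace q) := by
  have hE : ∀ r : MvPolynomial (Fin 3) ℝ,
      eulerOp (fun y => eval y r) = fun y => eval y (eulerDer r) := fun r => by
    funext y
    simp [eulerOp, pd_eval, eulerDer_apply, Fin.sum_univ_three]
  simp only [legendreOp, eulerStar, hE, lapOp, pd_eval]
  simp only [laplace_apply, map_add, map_sub, map_sum, smul_eval]
  ring

/-- If `q` has degree at most `N` and `Δ q = L (L + 1) q - N (N + 1) q`, then `q` agrees on the
unit sphere with a harmonic homogeneous polynomial of degree `N`. -/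
theorem exists_harmonic_eqOn_sphere (N : ℕ) (q : MvPolynomial (Fin 3) ℝ)
    (hdeg : q.totalDegree ≤ N)
    (hq : laplace q = eulerDer (eulerDer q) + eulerDer q - ((N : ℝ) * (N + 1)) • q) :
    ∃ h : MvPolynomial (Fin 3) ℝ, h.IsHomogeneous N ∧ laplace h = 0 ∧
      ∀ x : Fin 3 → ℝ, (∑ i, x i ^ 2) = 1 → eval x q = eval x h := by
  set φ : ℕ → MvPolynomial (Fin 3) ℝ := fun k => homogeneousComponent k q with hφ
  have hom : ∀ k, (φ k).IsHomogeneous k := fun k => homogeneousComponent_isHomogeneous k q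
  have hrec : ∀ k, laplace (φ (k + 2)) = ((k : ℝ) * (k + 1) - N * (N + 1)) • φ k := fun k => by
    have h := congrArg (homogeneousComponent k) hq
    rw [homogeneousComponent_laplace, map_sub, map_add, homogeneousComponent_eulerDer,
      homogeneousComponent_eulerDer, map_smul] at h
    rw [hφ, h]
    module
  have odd : ∀ i k, k + (2 * i + 1) = N → φ k = 0 := fun i => by
    induction i with
    | zero =>
      intro k hk
      have h := hrec k
      rw [show φ (k + 2) = 0 from homogeneousComponent_eq_zero _ _ (by omega), map_zero] at h
      refine (smul_eq_zero.1 h.symm).resolve_left (ne_of_lt ?_)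
      have : (N : ℝ) = k + 1 := by rw [← hk]; push_cast; ring
      rw [this]
      nlinarith [Nat.cast_nonneg (α := ℝ) k]
    | succ i ih =>
      intro k hk
      have h := hrec k
      rw [ih (k + 2) (by omega), map_zero] at h
      refine (smul_eq_zero.1 h.symm).resolve_left (ne_of_lt ?_)
      have : (k : ℝ) < N := by exact_mod_cast (by omega : k < N)
      nlinarith [Nat.cast_nonneg (α := ℝ) k]
  have tele : ∀ J, 2 * J ≤ N →
      laplace (∑ j ∈ Finset.range (J + 1), normSqPoly ^ j * φ (N - 2 * j)) =
        normSqPoly ^ J * laplace (φ (N - 2 * J)) := fun J => by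
    induction J with
    | zero => simp
    | succ J ih =>
      intro hJ
      obtain ⟨k, hk⟩ := Nat.exists_eq_add_of_le hJ
      have h2 : N - 2 * J = k + 2 := by omega
      have h3 : N - 2 * (J + 1) = k := by omega
      have hN : (N : ℝ) = 2 * (J + 1) + k := by exact_mod_cast hk
      rw [Finset.sum_range_succ, map_add, ih (by omega), h2, h3, hrec,
        laplace_normSqPoly_pow_mul J (hom k), mul_smul_comm, hN]
      module
  refine ⟨∑ j ∈ Finset.range (N / 2 + 1), normSqPoly ^ j * φ (N - 2 * j), ?_, ?_, ?_⟩
  · refine IsHomogeneous.sum _ _ _ fun j hj => ?_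
    rw [Finset.mem_range] at hj
    convert isHomogeneous_normSqPoly_pow_mul j (hom (N - 2 * j)) using 1
    omega
  · rw [tele _ (by omega), (hom _).laplace_eq_zero (by omega), mul_zero]
  · intro x hx
    have hR : eval x normSqPoly = 1 := by simpa [normSqPoly] using hx
    have hsum : q = ∑ k ∈ Finset.range (N + 1), φ k := by
      conv_lhs => rw [← sum_homogeneousComponent q]
      refine Finset.sum_subset (Finset.range_mono (by omega)) fun k _ hk => ?_
      exact homogeneousComponent_eq_zero _ _ (by simpa using hk)
    rw [hsum, ← Finset.sum_range_reflect, add_tsub_cancel_right, Finset.sum_range_eq_sum_even]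
    · simp [hR]
    · rintro j hj ⟨i, hi⟩
      exact odd i _ (by omega)

end MvPolynomial

open MvPolynomial in
/-- If `φ` is a polynomial of degree at most `n + 1` (with `n ≥ 1`) whose
gradient components satisfy `𝓛(∂ⱼφ) = n(n + 3)∂ⱼφ`, then on the unit sphere `φ` agrees,
up to an additive constant, with a harmonic homogeneous polynomial of degree `n + 1`
(i.e. a spherical harmonic of degree `n + 1`). -/
theorem stmt_19 (n : ℕ) (hn : 1 ≤ n) (p : MvPolynomial (Fin 3) ℝ)
    (hdeg : p.totalDegree ≤ n + 1)
    (heig : ∀ (j : Fin 3) (x : Fin 3 → ℝ),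
      legendreOp (pd j fun y => MvPolynomial.eval y p) x =
        (n * (n + 3) : ℝ) * pd j (fun y => MvPolynomial.eval y p) x) :
    ∃ (h : MvPolynomial (Fin 3) ℝ) (c : ℝ),
      h.IsHomogeneous (n + 1) ∧
      (∑ j : Fin 3, MvPolynomial.pderiv j (MvPolynomial.pderiv j h)) = 0 ∧
      ∀ x : Fin 3 → ℝ, (∑ i : Fin 3, x i ^ 2) = 1 →
        MvPolynomial.eval x p = MvPolynomial.eval x h + c := by
  set A : ℝ := ((n + 1 : ℕ) : ℝ) * ((n + 1 : ℕ) + 1) with hA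
  have hA0 : A ≠ 0 := by positivity
  set r := laplace p - (eulerDer (eulerDer p) + eulerDer p - A • p) with hr
  have hgrad : ∀ j, pderiv j r = 0 := fun j => by
    have h : eulerDer (eulerDer (pderiv j p)) + (3 : ℝ) • eulerDer (pderiv j p) -
        laplace (pderiv j p) = ((n : ℝ) * (n + 3)) • pderiv j p := by
      refine MvPolynomial.funext fun x => ?_
      rw [← legendreOp_eval, smul_eval]
      simpa only [pd_eval] using heig j x
    rw [laplace_pderiv, eulerDer_pderiv, map_sub, eulerDer_pderiv, eulerDer_pderiv] at h
    rw [hr, map_sub, map_sub, map_add, Derivation.map_smul, hA]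
    push_cast
    linear_combination (norm := module) (-1 : ℝ) • h
  obtain ⟨d, hd⟩ : ∃ d, r = C d := ⟨_, eq_C_of_pderiv_eq_zero hgrad⟩
  have hCE : ∀ a : ℝ, eulerDer (C a : MvPolynomial (Fin 3) ℝ) = 0 := fun a => by
    simp [eulerDer_apply]
  have hCL : ∀ a : ℝ, laplace (C a : MvPolynomial (Fin 3) ℝ) = 0 := fun a => by
    simp [laplace_apply]
  obtain ⟨h, hhom, hharm, heq⟩ := exists_harmonic_eqOn_sphere (n + 1) (p - C (d / A))
    ((totalDegree_sub _ _).trans (by simpa using hdeg)) (by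
      have hdA : A • (C (d / A) : MvPolynomial (Fin 3) ℝ) = C d := by
        rw [smul_eq_C_mul, ← C_mul, mul_div_cancel₀ _ hA0]
      rw [← hA, map_sub, map_sub, hCE, hCL, sub_zero, sub_zero, smul_sub, hdA, ← hd, hr]
      abel)
  refine ⟨h, d / A, hhom, by rw [← laplace_apply, hharm], fun x hx => ?_⟩
  rw [← heq x hx]
  simp
end
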